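/- Let α be a cardinal with uncountable cofinality cf(α), let γ be an infinite cardinal with γ < cf(α), let X = [0,α) be the space of ordinals less than the initial ordinal of α with the order topology, and let λ be the family of all nonempty C_γ-compact subsets of X. Then the λ-open topology makes C(X,ℝ^γ) a topological group under pointwise addition (indeed a locally convex topological vector space and a topological algebra over ℝ), while the λ-open topology on C(X,ℝ^{cf(α)}) does not make addition separately continuous (it is not a semitopological group). -/

import Mathlib

open Topology Set

/-- The λ-open (set-open) topology on `C(X, ι → ℝ)` generated by the subbasis
`[A, U] = {f | f(A) ⊆ U}` for `A ∈ Λ` and `U` open in `ι → ℝ`. -/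
def setOpenTopology {X : Type*} [TopologicalSpace X] (ι : Type*) (Λ : Set (Set X)) :
    TopologicalSpace C(X, ι → ℝ) :=
  TopologicalSpace.generateFrom
    {S | ∃ A ∈ Λ, ∃ U : Set (ι → ℝ), IsOpen U ∧ S = {f : C(X, ι → ℝ) | Set.MapsTo f A U}}

/-- A subset `B ⊆ X` is `C_ι`-compact in `X` if `f(B)` is compact in `ℝ^ι`
for every continuous `f : X → ℝ^ι`. -/
def CCompactIn {X : Type*} [TopologicalSpace X] (ι : Type*) (B : Set X) : Prop :=
  ∀ f : C(X, ι → ℝ), IsCompact (⇑f '' B)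

/-- The family `λ(C_ι)`. -/
def lambdaC {X : Type*} [TopologicalSpace X] (ι : Type*) (Λ : Set (Set X)) : Set (Set X) :=
  {A | A ∈ Λ ∧ ∀ B ⊆ A, CCompactIn ι B → ∀ U : Set (ι → ℝ), IsOpen U →
    IsOpen[setOpenTopology ι Λ] {f : C(X, ι → ℝ) | Set.MapsTo f B U}}

universe u

section SetOpen

variable {X : Type*} [TopologicalSpace X] {ι : Type*}

/-- The product of two copies of `ι → ℝ` is homeomorphic to `ι → ℝ` when `ι` is infinite. -/
theorem nonempty_homeomorph_prod_pi_real (ι : Type*) [Infinite ι] :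
    Nonempty ((ι → ℝ) × (ι → ℝ) ≃ₜ (ι → ℝ)) := by
  have h : Cardinal.mk (ι ⊕ ι) = Cardinal.mk ι := by
    simp [Cardinal.add_eq_self (Cardinal.aleph0_le_mk ι)]
  obtain ⟨e⟩ := Cardinal.eq.1 h
  exact ⟨Homeomorph.sumArrowHomeomorphProdArrow.symm.trans
    (Homeomorph.piCongrLeft (Y := fun _ => ℝ) e)⟩

theorem CCompactIn.isCompact_image {B : Set X} (hB : CCompactIn ι B) {Z : Type*}
    [TopologicalSpace Z] (e : Z ≃ₜ (ι → ℝ)) (f : C(X, Z)) : IsCompact (f '' B) := by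
  have h := hB ((e : C(Z, ι → ℝ)).comp f)
  rw [ContinuousMap.coe_comp, image_comp] at h
  exact e.isCompact_image.1 h

/-- The trace on a `C_ι`-compact set of the preimage of a closed set is `C_ι`-compact. -/
theorem CCompactIn.inter_preimage [Infinite ι] {B : Set X} (hB : CCompactIn ι B)
    (h : C(X, (ι → ℝ) × (ι → ℝ))) {K : Set ((ι → ℝ) × (ι → ℝ))} (hK : IsClosed K) :
    CCompactIn ι (B ∩ h ⁻¹' K) := by
  intro g
  obtain ⟨e⟩ := nonempty_homeomorph_prod_pi_real ι
  have hc := hB.isCompact_image ((e.prodCongr (Homeomorph.refl (ι → ℝ))).trans e) (h.prodMk g)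
  have := (hc.inter_right (hK.preimage continuous_fst)).image continuous_snd
  convert this using 1
  ext y
  constructor
  · rintro ⟨x, ⟨hxB, hxK⟩, rfl⟩
    exact ⟨_, ⟨⟨x, hxB, rfl⟩, hxK⟩, rfl⟩
  · rintro ⟨_, ⟨⟨x, hxB, rfl⟩, hxK⟩, rfl⟩
    exact ⟨x, ⟨hxB, hxK⟩, rfl⟩

theorem continuous_setOpenTopology_iff {Λ : Set (Set X)} {Y : Type*} [t : TopologicalSpace Y]
    {F : Y → C(X, ι → ℝ)} :
    Continuous[t, setOpenTopology ι Λ] F ↔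
      ∀ A ∈ Λ, ∀ U : Set (ι → ℝ), IsOpen U → IsOpen {y | MapsTo (F y) A U} := by
  rw [setOpenTopology, continuous_generateFrom_iff]
  constructor
  · intro h A hA U hU
    exact h _ ⟨A, hA, U, hU, rfl⟩
  · rintro h _ ⟨A, hA, U, hU, rfl⟩
    exact h A hA U hU

/-- For the family of all nonempty `C_ι`-compact sets, continuous binary operations on `ι → ℝ`
induce continuous operations for the set-open topology. -/
theorem continuous_setOpenTopology_map₂ [Infinite ι] {Y : Type*} [t : TopologicalSpace Y]
    {F G H : Y → C(X, ι → ℝ)}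
    (hF : Continuous[t, setOpenTopology ι {B | B.Nonempty ∧ CCompactIn ι B}] F)
    (hG : Continuous[t, setOpenTopology ι {B | B.Nonempty ∧ CCompactIn ι B}] G)
    {φ : (ι → ℝ) × (ι → ℝ) → ι → ℝ} (hφ : Continuous φ)
    (hH : ∀ y x, H y x = φ (F y x, G y x)) :
    Continuous[t, setOpenTopology ι {B | B.Nonempty ∧ CCompactIn ι B}] H := by
  rw [continuous_setOpenTopology_iff] at hF hG ⊢
  rintro A ⟨-, hA⟩ U hU
  rw [isOpen_iff_mem_nhds]
  intro y₀ hy₀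
  obtain ⟨e⟩ := nonempty_homeomorph_prod_pi_real ι
  set h : C(X, (ι → ℝ) × (ι → ℝ)) := (F y₀).prodMk (G y₀) with hh
  have key : ∀ᶠ y in 𝓝 y₀, ∀ x ∈ A, h x ∈ h '' A → φ (F y x, G y x) ∈ U := by
    refine (hA.isCompact_image e h).induction_on
      (p := fun s => ∀ᶠ y in 𝓝 y₀, ∀ x ∈ A, h x ∈ s → φ (F y x, G y x) ∈ U) ?_ ?_ ?_ ?_
    · simp
    · intro s s' hs hs'
      filter_upwards [hs'] with y hy x hx hxs using hy x hx (hs hxs)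
    · intro s s' hs hs'
      filter_upwards [hs, hs'] with y hy hy' x hx hxs using hxs.elim (hy x hx) (hy' x hx)
    · rintro _ ⟨x₀, hx₀, rfl⟩
      have hx₀U : φ (F y₀ x₀, G y₀ x₀) ∈ U := hH y₀ x₀ ▸ hy₀ hx₀
      obtain ⟨P, Q, hP, hxP, hQ, hxQ, hPQ⟩ :=
        mem_nhds_prod_iff'.1 (hφ.continuousAt.preimage_mem_nhds (hU.mem_nhds hx₀U))
      obtain ⟨P', hP', hP'c, hP'P⟩ := exists_mem_nhds_isClosed_subset (hP.mem_nhds hxP)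
      obtain ⟨Q', hQ', hQ'c, hQ'Q⟩ := exists_mem_nhds_isClosed_subset (hQ.mem_nhds hxQ)
      refine ⟨P' ×ˢ Q', mem_nhdsWithin_of_mem_nhds (prod_mem_nhds hP' hQ'), ?_⟩
      have hB : A ∩ h ⁻¹' (P' ×ˢ Q') ∈ {B : Set X | B.Nonempty ∧ CCompactIn ι B} :=
        ⟨⟨x₀, hx₀, mem_of_mem_nhds hP', mem_of_mem_nhds hQ'⟩,
          hA.inter_preimage h (hP'c.prod hQ'c)⟩
      have h₁ : ∀ᶠ y in 𝓝 y₀, MapsTo (F y) (A ∩ h ⁻¹' (P' ×ˢ Q')) P :=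
        (hF _ hB P hP).mem_nhds fun x hx => hP'P hx.2.1
      have h₂ : ∀ᶠ y in 𝓝 y₀, MapsTo (G y) (A ∩ h ⁻¹' (P' ×ˢ Q')) Q :=
        (hG _ hB Q hQ).mem_nhds fun x hx => hQ'Q hx.2.2
      filter_upwards [h₁, h₂] with y hy₁ hy₂ x hx hxs
      exact hPQ ⟨hy₁ ⟨hx, hxs⟩, hy₂ ⟨hx, hxs⟩⟩
  filter_upwards [key] with y hy x hx
  rw [hH]
  exact hy x hx (mem_image_of_mem _ hx)

theorem continuous_setOpenTopology_const {Λ : Set (Set X)} (hΛ : ∀ A ∈ Λ, A.Nonempty) :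
    Continuous[inferInstance, setOpenTopology ι Λ]
      (fun c : ℝ => ContinuousMap.const X (fun _ : ι => c)) := by
  rw [continuous_setOpenTopology_iff]
  intro A hA U hU
  convert hU.preimage (continuous_pi fun _ => continuous_id : Continuous fun (c : ℝ) (_ : ι) => c)
    using 1
  ext c
  obtain ⟨a, ha⟩ := hΛ A hA
  exact ⟨fun h => h ha, fun h _ _ => h⟩

/-- The set-open topology is locally convex at the origin. -/
theorem exists_convex_mem_nhds_zero_setOpenTopology {Λ : Set (Set X)}
    (hΛ : ∀ A ∈ Λ, A.Nonempty) {S : Set C(X, ι → ℝ)}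
    (hS : S ∈ @nhds _ (setOpenTopology ι Λ) 0) :
    ∃ T ∈ @nhds _ (setOpenTopology ι Λ) (0 : C(X, ι → ℝ)), Convex ℝ T ∧ T ⊆ S := by
  let := setOpenTopology ι Λ
  obtain ⟨O, hOS, hO, h0⟩ := mem_nhds_iff.1 hS
  suffices ∃ T ∈ 𝓝 (0 : C(X, ι → ℝ)), Convex ℝ T ∧ T ⊆ O by
    obtain ⟨T, hT, hTc, hTO⟩ := this
    exact ⟨T, hT, hTc, hTO.trans hOS⟩
  clear hS hOS
  induction hO with
  | basic s hs =>
    obtain ⟨A, hA, U, hU, rfl⟩ := hs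
    obtain ⟨a, ha⟩ := hΛ A hA
    have h0U : (0 : ι → ℝ) ∈ U := h0 ha
    obtain ⟨V, ⟨hV0, hVo, hVc⟩, hVU⟩ :=
      (LocallyConvexSpace.convex_open_basis_zero ℝ (ι → ℝ)).mem_iff.1 (hU.mem_nhds h0U)
    refine ⟨{f | MapsTo f A V}, IsOpen.mem_nhds
      (TopologicalSpace.GenerateOpen.basic _ ⟨A, hA, V, hVo, rfl⟩) fun _ _ => hV0, ?_,
      fun f hf => hf.mono_right hVU⟩
    intro f hf g hg a b ha hb hab x hx
    exact hVc (hf hx) (hg hx) ha hb hab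
  | univ => exact ⟨univ, Filter.univ_mem, convex_univ, subset_univ _⟩
  | inter s t _ _ ihs iht =>
    obtain ⟨T, hT, hTc, hTs⟩ := ihs h0.1
    obtain ⟨T', hT', hTc', hTs'⟩ := iht h0.2
    exact ⟨T ∩ T', Filter.inter_mem hT hT', hTc.inter hTc', inter_subset_inter hTs hTs'⟩
  | sUnion s _ ih =>
    obtain ⟨t, hts, h0t⟩ := h0
    obtain ⟨T, hT, hTc, hTt⟩ := ih t hts h0t
    exact ⟨T, hT, hTc, hTt.trans (subset_sUnion_of_mem hts)⟩

/-- A set-open neighbourhood of the origin contains every map vanishing on a suitable finite set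
of coordinates. -/
theorem exists_finset_forall_mem_of_isOpen_setOpenTopology {Λ : Set (Set X)}
    (hΛ : ∀ A ∈ Λ, A.Nonempty) {O : Set C(X, ι → ℝ)} (hO : IsOpen[setOpenTopology ι Λ] O)
    (h0 : 0 ∈ O) : ∃ s : Finset ι, ∀ f : C(X, ι → ℝ), (∀ x, ∀ i ∈ s, f x i = 0) → f ∈ O := by
  classical
  induction hO with
  | basic s hs =>
    obtain ⟨A, hA, U, hU, rfl⟩ := hs
    obtain ⟨a, ha⟩ := hΛ A hA
    have h0U : (0 : ι → ℝ) ∈ U := h0 ha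
    obtain ⟨s, V, hV, hVU⟩ := isOpen_pi_iff.1 hU _ h0U
    refine ⟨s, fun f hf x _ => hVU fun i hi => ?_⟩
    rw [hf x i hi]
    exact (hV i hi).2
  | univ => exact ⟨∅, fun _ _ => mem_univ _⟩
  | inter _ _ _ _ ihs iht =>
    obtain ⟨s, hs⟩ := ihs h0.1
    obtain ⟨t, ht⟩ := iht h0.2
    exact ⟨s ∪ t, fun f hf => ⟨hs f fun x i hi => hf x i (Finset.mem_union_left _ hi),
      ht f fun x i hi => hf x i (Finset.mem_union_right _ hi)⟩⟩
  | sUnion _ _ ih =>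
    obtain ⟨t, hts, h0t⟩ := h0
    obtain ⟨s, hs⟩ := ih t hts h0t
    exact ⟨s, fun f hf => ⟨t, hts, hs f hf⟩⟩

end SetOpen

section InitialSegment

theorem isCompact_setOf_le_ordinal {o : Ordinal} (β : {a : Ordinal // a < o}) :
    IsCompact {x : {a : Ordinal // a < o} | x ≤ β} := by
  rw [Subtype.isCompact_iff]
  convert isCompact_Icc (a := (0 : Ordinal)) (b := β.1) using 1
  ext x
  constructor
  · rintro ⟨y, hy, rfl⟩
    exact ⟨zero_le, hy⟩
  · rintro ⟨-, hx⟩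
    exact ⟨⟨x, hx.trans_lt β.2⟩, hx, rfl⟩

theorem isClopen_setOf_le_ordinal {o : Ordinal} (β : {a : Ordinal // a < o}) :
    IsClopen {x : {a : Ordinal // a < o} | x ≤ β} := by
  refine ⟨isClosed_Iic.preimage continuous_subtype_val (t := Iic β.1), ?_⟩
  convert (isOpen_Iio (a := Order.succ β.1)).preimage continuous_subtype_val using 1
  ext x
  exact (Order.lt_succ_iff (a := x.1)).symm

/-- The ordinals below `o` form a `C_ι`-compact space when `ι` is infinite and smaller than the
cofinality of `o`. -/
theorem cCompactIn_univ_ordinal {o : Ordinal.{u}} {ι : Type u} [Infinite ι]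
    (hι : Cardinal.mk ι < o.cof) : CCompactIn ι (univ : Set {a : Ordinal.{u} // a < o}) := by
  classical
  intro f
  let U : Finset (ι × ℚ × ℚ) → Set (ι → ℝ) :=
    fun s => {v | ∀ p ∈ s, v p.1 ∈ Ioo (p.2.1 : ℝ) (p.2.2 : ℝ)}
  have ho : 0 < o := by
    rw [pos_iff_ne_zero]
    rintro rfl
    simp at hι
  have hex : ∀ s, ∃ x : {a : Ordinal.{u} // a < o}, (∃ y, f y ∈ U s) → f x ∈ U s := by
    intro s
    by_cases h : ∃ y, f y ∈ U s
    · exact h.imp fun _ hy _ => hy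
    · exact ⟨⟨0, ho⟩, fun h' => absurd h' h⟩
  choose x hx using hex
  have hcard : Cardinal.mk (Finset (ι × ℚ × ℚ)) < o.cof := by
    rw [Cardinal.mk_finset_of_infinite]
    have : Cardinal.mk (ι × ℚ × ℚ) = Cardinal.mk ι := by
      simp [Cardinal.mul_aleph0_eq (Cardinal.aleph0_le_mk ι)]
    rwa [this]
  let β : {a : Ordinal.{u} // a < o} :=
    ⟨⨆ s, (x s).1, Ordinal.iSup_lt_of_lt_cof hcard fun s => (x s).2⟩
  have hβ : ∀ s, x s ≤ β := fun s => Ordinal.le_iSup (fun s => (x s).1) s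
  have hK : IsCompact (f '' {y | y ≤ β}) := (isCompact_setOf_le_ordinal β).image f.continuous
  suffices f '' univ = f '' {y | y ≤ β} by rwa [this]
  refine Subset.antisymm ?_ (image_mono (subset_univ _))
  rintro _ ⟨y, -, rfl⟩
  by_contra hy
  obtain ⟨s, V, hV, hVU⟩ := isOpen_pi_iff.1 hK.isClosed.isOpen_compl _ hy
  have hab : ∀ i : ι, ∃ a b : ℚ, i ∈ s → f y i ∈ Ioo (a : ℝ) b ∧ Ioo (a : ℝ) b ⊆ V i := by
    intro i
    by_cases hi : i ∈ s
    · obtain ⟨t, ht, hyt, htV⟩ := Real.isTopologicalBasis_Ioo_rat.exists_subset_of_mem_open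
        (hV i hi).2 (hV i hi).1
      simp only [mem_iUnion, mem_singleton_iff] at ht
      obtain ⟨a, b, -, rfl⟩ := ht
      exact ⟨a, b, fun _ => ⟨hyt, htV⟩⟩
    · exact ⟨0, 0, fun h => absurd h hi⟩
  choose a b hab using hab
  let S : Finset (ι × ℚ × ℚ) := s.image fun i => (i, a i, b i)
  have hyS : f y ∈ U S := by
    intro p hp
    obtain ⟨i, hi, rfl⟩ := Finset.mem_image.1 hp
    exact (hab i hi).1
  refine hVU (fun i hi => (hab i hi).2 ?_) (mem_image_of_mem f (hβ S))
  exact hx S ⟨y, hyS⟩ (i, a i, b i) (Finset.mem_image_of_mem _ hi)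

theorem exists_cofinal_family_ordinal {o : Ordinal.{u}} {ι : Type u}
    (hι : Cardinal.mk ι = o.cof) :
    ∃ q : ι → {a : Ordinal.{u} // a < o}, ∀ x, ∃ i, x ≤ q i := by
  obtain ⟨s, hs, hs'⟩ := Order.exists_cof_eq o.ToType
  rw [Ordinal.cof_toType, ← hι] at hs'
  obtain ⟨e⟩ := Cardinal.eq.1 hs'
  refine ⟨fun i => Ordinal.ToType.mk.symm (e.symm i).1, fun x => ?_⟩
  obtain ⟨b, hb, hxb⟩ := hs (Ordinal.ToType.mk x)
  exact ⟨e ⟨b, hb⟩, by simpa using! (OrderIso.le_symm_apply _).2 hxb⟩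

/-- If the whole space belongs to `Λ`, addition on `C([0, o), ι → ℝ)` is not separately continuous
for the set-open topology, where `ι` has the cardinality of the cofinality of `o`. -/
theorem exists_not_continuous_add_setOpenTopology {o : Ordinal.{u}} {ι : Type u}
    (ho : Order.IsSuccLimit o) (hι : Cardinal.mk ι = o.cof)
    {Λ : Set (Set {a : Ordinal.{u} // a < o})} (hΛ : ∀ A ∈ Λ, A.Nonempty) (huniv : univ ∈ Λ) :
    ∃ g : C({a : Ordinal.{u} // a < o}, ι → ℝ),
      ¬ Continuous[setOpenTopology ι Λ, setOpenTopology ι Λ] (fun f => f + g) := by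
  classical
  obtain ⟨q, hq⟩ := exists_cofinal_family_ordinal hι
  let c : ι → C({a : Ordinal.{u} // a < o}, ℝ) := fun i =>
    ⟨indicator {x | x ≤ q i} 1, (isClopen_setOf_le_ordinal (q i)).continuous_indicator
      continuous_one⟩
  have hc : ∀ i x, c i x = indicator {x | x ≤ q i} 1 x := fun _ _ => rfl
  refine ⟨ContinuousMap.pi c, fun hcont => ?_⟩
  let := setOpenTopology ι Λ
  have hO := continuous_setOpenTopology_iff.1 hcont univ huniv {0}ᶜ isOpen_compl_singleton
  obtain ⟨s, hs⟩ := exists_finset_forall_mem_of_isOpen_setOpenTopology hΛ hO <| by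
    intro x _ h0
    obtain ⟨i, hi⟩ := hq x
    have := congrFun h0 i
    simp [hc, hi] at this
  let x : {a : Ordinal.{u} // a < o} := ⟨Order.succ (s.sup fun i => (q i).1), ho.succ_lt <|
    (Finset.sup_lt_iff ho.bot_lt).2 fun i _ => (q i).2⟩
  have hx : ∀ i ∈ s, ¬ x ≤ q i := fun i hi => not_le.2 <|
    Order.lt_succ_of_le (Finset.le_sup (f := fun i => (q i).1) hi)
  refine hs (ContinuousMap.pi fun i => if i ∈ s then 0 else -c i) ?_ (mem_univ x) ?_
  · intro y i hi
    simp [hi]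
  · funext i
    by_cases hi : i ∈ s
    · simp [hi, hc, hx i hi]
    · simp [hi]

end InitialSegment

/-- For a cardinal `α` with uncountable cofinality, an infinite `γ < cf(α)`,
`X = [0, α)` and `λ` the family of all nonempty `C_γ`-compact subsets of `X`:
the `λ`-open topology makes `C(X, ℝ^γ)` a topological group, indeed a locally convex
topological vector space and a topological algebra over `ℝ`, while the `λ`-open
topology on `C(X, ℝ^{cf α})` is not a semitopological group. -/
theorem statement_18 (α : Cardinal.{u}) (hcof : Cardinal.aleph0 < (Cardinal.ord α).cof)
    (γ : Cardinal.{u}) (hγ : Cardinal.aleph0 ≤ γ) (hγcof : γ < (Cardinal.ord α).cof)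
    (ι ι' : Type u) (hι : Cardinal.mk ι = γ) (hι' : Cardinal.mk ι' = (Cardinal.ord α).cof) :
    ∀ Λ : Set (Set {o : Ordinal.{u} // o < Cardinal.ord α}),
      Λ = {B | B.Nonempty ∧ CCompactIn ι B} →
      (Continuous[@instTopologicalSpaceProd _ _ (setOpenTopology ι Λ) (setOpenTopology ι Λ),
          setOpenTopology ι Λ]
          (fun p : C({o : Ordinal.{u} // o < Cardinal.ord α}, ι → ℝ) ×
              C({o : Ordinal.{u} // o < Cardinal.ord α}, ι → ℝ) => p.1 + p.2) ∧
        Continuous[setOpenTopology ι Λ, setOpenTopology ι Λ]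
          (fun f : C({o : Ordinal.{u} // o < Cardinal.ord α}, ι → ℝ) => -f) ∧
        Continuous[@instTopologicalSpaceProd _ _ inferInstance (setOpenTopology ι Λ),
          setOpenTopology ι Λ]
          (fun p : ℝ × C({o : Ordinal.{u} // o < Cardinal.ord α}, ι → ℝ) => p.1 • p.2) ∧
        (∀ S ∈ @nhds _ (setOpenTopology ι Λ)
            (0 : C({o : Ordinal.{u} // o < Cardinal.ord α}, ι → ℝ)),
          ∃ T ∈ @nhds _ (setOpenTopology ι Λ)
            (0 : C({o : Ordinal.{u} // o < Cardinal.ord α}, ι → ℝ)),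
            Convex ℝ T ∧ T ⊆ S) ∧
        Continuous[@instTopologicalSpaceProd _ _ (setOpenTopology ι Λ) (setOpenTopology ι Λ),
          setOpenTopology ι Λ]
          (fun p : C({o : Ordinal.{u} // o < Cardinal.ord α}, ι → ℝ) ×
              C({o : Ordinal.{u} // o < Cardinal.ord α}, ι → ℝ) => p.1 * p.2)) ∧
      ¬ (∀ g : C({o : Ordinal.{u} // o < Cardinal.ord α}, ι' → ℝ),
          Continuous[setOpenTopology ι' Λ, setOpenTopology ι' Λ] (fun f => f + g) ∧
          Continuous[setOpenTopology ι' Λ, setOpenTopology ι' Λ] (fun f => g + f)) := by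
  rintro Λ rfl
  have : Infinite ι := Cardinal.infinite_iff.2 (hι ▸ hγ)
  have hne : ∀ A ∈ {B : Set {o : Ordinal.{u} // o < Cardinal.ord α} | B.Nonempty ∧ CCompactIn ι B},
    A.Nonempty := fun A hA => hA.1
  have ho : Order.IsSuccLimit (Cardinal.ord α) :=
    Ordinal.one_lt_cof_iff.1 (Cardinal.one_lt_aleph0.trans hcof)
  have huniv : CCompactIn ι (univ : Set {o : Ordinal.{u} // o < Cardinal.ord α}) :=
    cCompactIn_univ_ordinal (hι ▸ hγcof)
  refine ⟨⟨?_, ?_, ?_, fun S hS => exists_convex_mem_nhds_zero_setOpenTopology hne hS, ?_⟩, ?_⟩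
  · let := setOpenTopology ι
      {B : Set {o : Ordinal.{u} // o < Cardinal.ord α} | B.Nonempty ∧ CCompactIn ι B}
    exact continuous_setOpenTopology_map₂ continuous_fst continuous_snd continuous_add
      fun _ _ => rfl
  · let := setOpenTopology ι
      {B : Set {o : Ordinal.{u} // o < Cardinal.ord α} | B.Nonempty ∧ CCompactIn ι B}
    exact continuous_setOpenTopology_map₂ continuous_id continuous_id continuous_fst.neg
      fun _ _ => rfl
  · let := setOpenTopology ι
      {B : Set {o : Ordinal.{u} // o < Cardinal.ord α} | B.Nonempty ∧ CCompactIn ι B}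
    exact continuous_setOpenTopology_map₂
      ((continuous_setOpenTopology_const hne).comp continuous_fst) continuous_snd continuous_mul
      fun _ _ => rfl
  · let := setOpenTopology ι
      {B : Set {o : Ordinal.{u} // o < Cardinal.ord α} | B.Nonempty ∧ CCompactIn ι B}
    exact continuous_setOpenTopology_map₂ continuous_fst continuous_snd continuous_mul
      fun _ _ => rfl
  · intro h
    obtain ⟨g, hg⟩ := exists_not_continuous_add_setOpenTopology ho hι' hne
      ⟨⟨⟨0, ho.bot_lt⟩, mem_univ _⟩, huniv⟩
    exact hg (h g).1
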